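/- arXiv:1902.03936 — 13 statements merged into one kernel-verified Lean document; each statement's English description precedes it below -/
import Mathlib

section
/- Let (V_n) be a generalized Tetranacci sequence and (M_n) the Tetranacci numbers, both indexed over all integers. Then for all integers m ≥ 0 and n ≥ 0, V_{m+n} = M_{m-2}·V_{n+3} + (M_{m-3}+M_{m-4}+M_{m-5})·V_{n+2} + (M_{m-3}+M_{m-4})·V_{n+1} + M_{m-3}·V_n. -/
/-- An integer sequence satisfying the Tetranacci recurrence and vanishing at `0, 1, 2, 3` vanishes
at every nonnegative index. -/
theorem tetranacci_eq_zero_of_initial (D : ℤ → ℤ)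
    (hD : ∀ n : ℤ, D n = D (n - 1) + D (n - 2) + D (n - 3) + D (n - 4))
    (h0 : D 0 = 0) (h1 : D 1 = 0) (h2 : D 2 = 0) (h3 : D 3 = 0) (m : ℤ) (hm : 0 ≤ m) :
    D m = 0 := by
  have key : ∀ k : ℕ, D k = 0 ∧ D (k + 1) = 0 ∧ D (k + 2) = 0 ∧ D (k + 3) = 0 := by
    intro k
    induction k with
    | zero => simp [h0, h1, h2, h3]
    | succ k ih =>
      obtain ⟨a, b, c, d⟩ := ih
      have e := hD (k + 4)
      ring_nf at a b c d e ⊢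
      push_cast
      ring_nf
      refine ⟨b, c, d, ?_⟩
      rw [e, a, b, c, d]
      rfl
  lift m to ℕ using hm
  exact (key m).1

/-- For a generalized Tetranacci sequence `V` and the Tetranacci
numbers `M`, both indexed over all integers, for all integers `m ≥ 0` and `n ≥ 0`,
`V (m+n) = M (m-2) * V (n+3) + (M (m-3)+M (m-4)+M (m-5)) * V (n+2)
  + (M (m-3)+M (m-4)) * V (n+1) + M (m-3) * V n`. -/
theorem generalized_tetranacci_addition_formula
    (V M : ℤ → ℤ)
    (hV : ∀ n : ℤ, V n = V (n - 1) + V (n - 2) + V (n - 3) + V (n - 4))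
    (hM0 : M 0 = 0) (hM1 : M 1 = 1) (hM2 : M 2 = 1) (hM3 : M 3 = 2)
    (hM : ∀ n : ℤ, M n = M (n - 1) + M (n - 2) + M (n - 3) + M (n - 4)) :
    ∀ m n : ℤ, 0 ≤ m → 0 ≤ n →
      V (m + n) =
        M (m - 2) * V (n + 3) + (M (m - 3) + M (m - 4) + M (m - 5)) * V (n + 2)
          + (M (m - 3) + M (m - 4)) * V (n + 1) + M (m - 3) * V n := by
  intro m n hm _
  have hMneg1 : M (-1) = 0 := by have := hM 3; norm_num at this; omega
  have hMneg2 : M (-2) = 0 := by have := hM 2; norm_num at this; omega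
  have hMneg3 : M (-3) = 1 := by have := hM 1; norm_num at this; omega
  have hMneg4 : M (-4) = -1 := by have := hM 0; norm_num at this; omega
  have hMneg5 : M (-5) = 0 := by have := hM (-1); norm_num at this; omega
  refine sub_eq_zero.mp (tetranacci_eq_zero_of_initial (fun m => V (m + n) -
    (M (m - 2) * V (n + 3) + (M (m - 3) + M (m - 4) + M (m - 5)) * V (n + 2)
      + (M (m - 3) + M (m - 4)) * V (n + 1) + M (m - 3) * V n)) ?_ ?_ ?_ ?_ ?_ m hm)
  · intro k
    have hVk := hV (k + n)
    have hMk2 := hM (k - 2)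
    have hMk3 := hM (k - 3)
    have hMk4 := hM (k - 4)
    have hMk5 := hM (k - 5)
    linear_combination (norm := ring_nf) hVk - V (n + 3) * hMk2
      - (V (n + 2) + V (n + 1) + V n) * hMk3
      - (V (n + 2) + V (n + 1)) * hMk4 - V (n + 2) * hMk5
  all_goals
    norm_num [hM0, hM1, hMneg1, hMneg2, hMneg3, hMneg4, hMneg5, add_comm]
end

section
/- Let (V_n) be a generalized Tetranacci sequence and (M_n) the Tetranacci numbers, both indexed over all integers. Then for all integers n ≥ 0, V_n = M_{n-3}·V_0 + (M_{n-3}+M_{n-4})·V_1 + (M_{n-3}+M_{n-4}+M_{n-5})·V_2 + M_{n-2}·V_3. -/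
/-- A sequence satisfying the Tetranacci recurrence is determined on the nonnegative integers
by its values at `0, 1, 2, 3`. -/
theorem tetranacci_recurrence_unique {R : Type*} [Add R] {V W : ℤ → R}
    (hV : ∀ n : ℤ, V n = V (n - 1) + V (n - 2) + V (n - 3) + V (n - 4))
    (hW : ∀ n : ℤ, W n = W (n - 1) + W (n - 2) + W (n - 3) + W (n - 4))
    (h0 : V 0 = W 0) (h1 : V 1 = W 1) (h2 : V 2 = W 2) (h3 : V 3 = W 3)
    (n : ℤ) (hn : 0 ≤ n) : V n = W n := by
  lift n to ℕ using hn
  induction n using Nat.strong_induction_on with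
  | _ n ih =>
    match n with
    | 0 => exact h0
    | 1 => exact h1
    | 2 => exact h2
    | 3 => exact h3
    | k + 4 =>
      have e1 : ((k + 4 : ℕ) : ℤ) - 1 = (k + 3 : ℕ) := by omega
      have e2 : ((k + 4 : ℕ) : ℤ) - 2 = (k + 2 : ℕ) := by omega
      have e3 : ((k + 4 : ℕ) : ℤ) - 3 = (k + 1 : ℕ) := by omega
      have e4 : ((k + 4 : ℕ) : ℤ) - 4 = (k : ℕ) := by omega
      rw [hV, hW, e1, e2, e3, e4, ih (k + 3) (by omega), ih (k + 2) (by omega),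
        ih (k + 1) (by omega), ih k (by omega)]

/-- Binet-type formula: for a generalized Tetranacci sequence `V` and
the Tetranacci numbers `M`, for all integers `n ≥ 0`,
`V n = M (n-3) * V 0 + (M (n-3)+M (n-4)) * V 1 + (M (n-3)+M (n-4)+M (n-5)) * V 2
  + M (n-2) * V 3`. -/
theorem generalized_tetranacci_binet_via_tetranacci
    (V M : ℤ → ℤ)
    (hV : ∀ n : ℤ, V n = V (n - 1) + V (n - 2) + V (n - 3) + V (n - 4))
    (hM0 : M 0 = 0) (hM1 : M 1 = 1) (hM2 : M 2 = 1) (hM3 : M 3 = 2)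
    (hM : ∀ n : ℤ, M n = M (n - 1) + M (n - 2) + M (n - 3) + M (n - 4)) :
    ∀ n : ℤ, 0 ≤ n →
      V n = M (n - 3) * V 0 + (M (n - 3) + M (n - 4)) * V 1
          + (M (n - 3) + M (n - 4) + M (n - 5)) * V 2 + M (n - 2) * V 3 := by
  have m1 : M (-1) = 0 := by have := hM 3; norm_num at this; linarith
  have m2 : M (-2) = 0 := by have := hM 2; norm_num at this; linarith
  have m3 : M (-3) = 1 := by have := hM 1; norm_num at this; linarith
  have m4 : M (-4) = -1 := by have := hM 0; norm_num at this; linarith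
  have m5 : M (-5) = 0 := by have := hM (-1); norm_num at this; linarith
  refine tetranacci_recurrence_unique hV (fun n => ?_) ?_ ?_ ?_ ?_
  · have shift (c : ℤ) : M (n - c) =
        M (n - 1 - c) + M (n - 2 - c) + M (n - 3 - c) + M (n - 4 - c) := by
      rw [hM (n - c)]
      simp only [sub_right_comm n c]
    rw [shift 2, shift 3, shift 4, shift 5]
    ring
  all_goals norm_num [m1, m2, m3, m4, m5, hM0, hM1]
end

section
/- Let (GV_n) be a Gaussian generalized Tetranacci sequence indexed over all integers. Then for all integers n ≥ 1: (a) 3·∑_{k=1}^{n} GV_k = GV_{n+2} + 2GV_n + GV_{n-1} - GV_0 + GV_1 - GV_3; (b) 3·∑_{k=1}^{n} GV_{2k+1} = 2GV_{2n+2} + GV_{2n} - GV_{2n-1} - 2GV_0 - GV_1 - 3GV_2 + GV_3; (c) 3·∑_{k=1}^{n} GV_{2k} = 2GV_{2n+1} + GV_{2n-1} - GV_{2n-2} + GV_0 - GV_1 + 3GV_2 - 2GV_3. -/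
/-- The imaginary unit of the Gaussian integers `ℤ[i]`. -/
def gaussI : GaussianInt := Zsqrtd.sqrtd

/-- Telescoping over an integer interval: a sum whose terms, scaled by `c`, are the increments of
`g` is determined by the end values of `g`. -/
theorem mul_sum_Icc_one_eq_sub_of_forall_eq_sub {R : Type*} [CommRing R] (c : R) (f g : ℤ → R)
    (h : ∀ k, c * f k = g k - g (k - 1)) (n : ℤ) (hn : 1 ≤ n) :
    c * ∑ k ∈ Finset.Icc (1 : ℤ) n, f k = g n - g 0 := by
  induction n, hn using Int.leInduction with
  | base => simp [h]
  | succ n hn ih =>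
    rw [← Finset.insert_Icc_right_eq_Icc_add_one (by lia), Finset.sum_insert (by simp), mul_add,
      ih, h, add_sub_cancel_right]
    ring

/-- summation formulas for Gaussian generalized Tetranacci numbers. -/
theorem gaussian_generalized_tetranacci_sums
    (c₀ c₁ c₂ c₃ : ℤ) (GV : ℤ → GaussianInt)
    (h0 : GV 0 = (c₀ : GaussianInt) + ((c₃ - c₂ - c₁ - c₀ : ℤ) : GaussianInt) * gaussI)
    (h1 : GV 1 = (c₁ : GaussianInt) + (c₀ : GaussianInt) * gaussI)
    (h2 : GV 2 = (c₂ : GaussianInt) + (c₁ : GaussianInt) * gaussI)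
    (h3 : GV 3 = (c₃ : GaussianInt) + (c₂ : GaussianInt) * gaussI)
    (hrec : ∀ n : ℤ, GV n = GV (n - 1) + GV (n - 2) + GV (n - 3) + GV (n - 4)) :
    ∀ n : ℤ, 1 ≤ n →
      (3 * ∑ k ∈ Finset.Icc (1 : ℤ) n, GV k =
          GV (n + 2) + 2 * GV n + GV (n - 1) - GV 0 + GV 1 - GV 3) ∧
      (3 * ∑ k ∈ Finset.Icc (1 : ℤ) n, GV (2 * k + 1) =
          2 * GV (2 * n + 2) + GV (2 * n) - GV (2 * n - 1)
            - 2 * GV 0 - GV 1 - 3 * GV 2 + GV 3) ∧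
      (3 * ∑ k ∈ Finset.Icc (1 : ℤ) n, GV (2 * k) =
          2 * GV (2 * n + 1) + GV (2 * n - 1) - GV (2 * n - 2)
            + GV 0 - GV 1 + 3 * GV 2 - 2 * GV 3) := by
  intro n hn
  have e2 := hrec 2
  have e3 := hrec 3
  norm_num at e2 e3
  refine ⟨?_, ?_, ?_⟩
  · rw [mul_sum_Icc_one_eq_sub_of_forall_eq_sub 3 GV
      (fun k => GV (k + 2) + 2 * GV k + GV (k - 1)) (fun k => ?_) n hn]
    · norm_num
      linear_combination e3
    · have e := hrec (k + 2)
      ring_nf at e ⊢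
      linear_combination -e
  · rw [mul_sum_Icc_one_eq_sub_of_forall_eq_sub 3 (fun k => GV (2 * k + 1))
      (fun k => 2 * GV (2 * k + 2) + GV (2 * k) - GV (2 * k - 1)) (fun k => ?_) n hn]
    · norm_num
      linear_combination -e3
    · have e := hrec (2 * k + 2)
      have e' := hrec (2 * k + 1)
      ring_nf at e e' ⊢
      linear_combination e' - 2 * e
  · rw [mul_sum_Icc_one_eq_sub_of_forall_eq_sub 3 (fun k => GV (2 * k))
      (fun k => 2 * GV (2 * k + 1) + GV (2 * k - 1) - GV (2 * k - 2)) (fun k => ?_) n hn]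
    · norm_num
      linear_combination 2 * e3 - e2
    · have e := hrec (2 * k + 1)
      have e' := hrec (2 * k)
      ring_nf at e e' ⊢
      linear_combination e' - 2 * e
end

section
/- Let (GM_n) be the Gaussian Tetranacci numbers indexed over all integers. Then for all integers n ≥ 1: (a) 3·∑_{k=1}^{n} GM_k = GM_{n+2} + 2GM_n + GM_{n-1} - (1+i); (b) 3·∑_{k=1}^{n} GM_{2k+1} = 2GM_{2n+2} + GM_{2n} - GM_{2n-1} - 2 - 2i; (c) 3·∑_{k=1}^{n} GM_{2k} = 2GM_{2n+1} + GM_{2n-1} - GM_{2n-2} - 2 + i. -/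
/-- Peeling off the last term of a sum over an integer interval starting at `1`. -/
theorem sum_Icc_one_int_succ {M : Type*} [AddCommMonoid M] (f : ℤ → M) {n : ℤ} (hn : 1 ≤ n) :
    ∑ k ∈ Finset.Icc (1 : ℤ) (n + 1), f k = ∑ k ∈ Finset.Icc (1 : ℤ) n, f k + f (n + 1) := by
  have hIcc : Finset.Icc (1 : ℤ) (n + 1) = insert (n + 1) (Finset.Icc 1 n) := by
    ext k
    simp only [Finset.mem_Icc, Finset.mem_insert]
    omega
  rw [hIcc, Finset.sum_insert (by simp), add_comm]

/-- summation formulas for Gaussian Tetranacci numbers. -/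
theorem gaussian_tetranacci_sums
    (GM : ℤ → GaussianInt)
    (h0 : GM 0 = 0) (h1 : GM 1 = 1) (h2 : GM 2 = 1 + gaussI) (h3 : GM 3 = 2 + gaussI)
    (hrec : ∀ n : ℤ, GM n = GM (n - 1) + GM (n - 2) + GM (n - 3) + GM (n - 4)) :
    ∀ n : ℤ, 1 ≤ n →
      (3 * ∑ k ∈ Finset.Icc (1 : ℤ) n, GM k =
          GM (n + 2) + 2 * GM n + GM (n - 1) - (1 + gaussI)) ∧
      (3 * ∑ k ∈ Finset.Icc (1 : ℤ) n, GM (2 * k + 1) =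
          2 * GM (2 * n + 2) + GM (2 * n) - GM (2 * n - 1) - 2 - 2 * gaussI) ∧
      (3 * ∑ k ∈ Finset.Icc (1 : ℤ) n, GM (2 * k) =
          2 * GM (2 * n + 1) + GM (2 * n - 1) - GM (2 * n - 2) - 2 + gaussI) := by
  have hstep (m : ℤ) : GM (m + 4) = GM (m + 3) + GM (m + 2) + GM (m + 1) + GM m := by
    rw [hrec (m + 4)]
    ring_nf
  intro n hn
  induction n, hn using Int.leInduction with
  | base =>
    have h4 : GM 4 = GM 3 + GM 2 + GM 1 + GM 0 := by simpa using hstep 0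
    norm_num [h0, h1, h2, h3, h4]
    refine ⟨?_, ?_, ?_⟩ <;> ring
  | succ n hn ih =>
    obtain ⟨iha, ihb, ihc⟩ := ih
    simp only [sum_Icc_one_int_succ _ hn, mul_add, iha, ihb, ihc]
    have ha := hstep (n - 1)
    have hb := hstep (2 * n)
    have hb' := hstep (2 * n - 1)
    have hc := hstep (2 * n - 2)
    ring_nf at ha hb hb' hc ⊢
    refine ⟨?_, ?_, ?_⟩
    · linear_combination -ha
    · linear_combination -2 * hb + hb'
    · linear_combination -2 * hb' + hc
end

section
/- Let (GR_n) be the Gaussian Tetranacci-Lucas numbers indexed over all integers. Then for all integers n ≥ 1: (a) 3·∑_{k=1}^{n} GR_k = GR_{n+2} + 2GR_n + GR_{n-1} - 10 + 2i; (b) 3·∑_{k=1}^{n} GR_{2k+1} = 2GR_{2n+2} + GR_{2n} - GR_{2n-1} - 11 - 2i; (c) 3·∑_{k=1}^{n} GR_{2k} = 2GR_{2n+1} + GR_{2n-1} - GR_{2n-2} - 2 - 8i. -/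
/-- summation formulas for Gaussian Tetranacci-Lucas numbers. -/
theorem gaussian_tetranacci_lucas_sums
    (GR : ℤ → GaussianInt)
    (h0 : GR 0 = 4 - gaussI) (h1 : GR 1 = 1 + 4 * gaussI)
    (h2 : GR 2 = 3 + gaussI) (h3 : GR 3 = 7 + 3 * gaussI)
    (hrec : ∀ n : ℤ, GR n = GR (n - 1) + GR (n - 2) + GR (n - 3) + GR (n - 4)) :
    ∀ n : ℤ, 1 ≤ n →
      (3 * ∑ k ∈ Finset.Icc (1 : ℤ) n, GR k =
          GR (n + 2) + 2 * GR n + GR (n - 1) - 10 + 2 * gaussI) ∧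
      (3 * ∑ k ∈ Finset.Icc (1 : ℤ) n, GR (2 * k + 1) =
          2 * GR (2 * n + 2) + GR (2 * n) - GR (2 * n - 1) - 11 - 2 * gaussI) ∧
      (3 * ∑ k ∈ Finset.Icc (1 : ℤ) n, GR (2 * k) =
          2 * GR (2 * n + 1) + GR (2 * n - 1) - GR (2 * n - 2) - 2 - 8 * gaussI) := by
  have hrec_add (m j : ℤ) :
      GR (m + j) = GR (m + (j - 1)) + GR (m + (j - 2)) + GR (m + (j - 3)) + GR (m + (j - 4)) := by
    rw [hrec (m + j)]
    simp only [add_sub_assoc]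
  have h4 : GR 4 = 15 + 7 * gaussI := by
    have h := hrec 4
    norm_num [h0, h1, h2, h3] at h
    linear_combination h
  intro n hn
  induction n, hn using Int.leInduction with
  | base =>
    norm_num [h0, h1, h2, h3, h4]
    refine ⟨?_, ?_, ?_⟩ <;> ring
  | succ n hn ih =>
    obtain ⟨ha, hb, hc⟩ := ih
    have hIcc : Finset.Icc (1 : ℤ) (n + 1) = insert (n + 1) (Finset.Icc 1 n) := by
      ext k
      simp only [Finset.mem_Icc, Finset.mem_insert]
      omega
    have hnotMem : n + 1 ∉ Finset.Icc (1 : ℤ) n := by simp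
    simp only [hIcc, Finset.sum_insert hnotMem]
    have r₁ := hrec_add n 3
    have r₂ := hrec_add (2 * n) 4
    have r₃ := hrec_add (2 * n) 3
    have r₄ := hrec_add (2 * n) 2
    ring_nf at ha hb hc r₁ r₂ r₃ r₄ ⊢
    refine ⟨?_, ?_, ?_⟩
    · linear_combination ha - r₁
    · linear_combination hb - 2 * r₂ + r₃
    · linear_combination hc - 2 * r₃ + r₄
end

section
/- Let (V_n) be a generalized Tetranacci sequence indexed over all integers. Then for all integers n ≥ 1: (a) 3·∑_{k=1}^{n} V_k = V_{n+2} + 2V_n + V_{n-1} - V_0 + V_1 - V_3; (b) 3·∑_{k=1}^{n} V_{2k+1} = 2V_{2n+2} + V_{2n} - V_{2n-1} - 2V_0 - V_1 - 3V_2 + V_3; (c) 3·∑_{k=1}^{n} V_{2k} = 2V_{2n+1} + V_{2n-1} - V_{2n-2} + V_0 - V_1 + 3V_2 - 2V_3. -/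
/-- summation formulas for a generalized Tetranacci sequence. -/
theorem generalized_tetranacci_sums
    (V : ℤ → ℤ)
    (hV : ∀ n : ℤ, V n = V (n - 1) + V (n - 2) + V (n - 3) + V (n - 4)) :
    ∀ n : ℤ, 1 ≤ n →
      (3 * ∑ k ∈ Finset.Icc (1 : ℤ) n, V k =
          V (n + 2) + 2 * V n + V (n - 1) - V 0 + V 1 - V 3) ∧
      (3 * ∑ k ∈ Finset.Icc (1 : ℤ) n, V (2 * k + 1) =
          2 * V (2 * n + 2) + V (2 * n) - V (2 * n - 1)
            - 2 * V 0 - V 1 - 3 * V 2 + V 3) ∧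
      (3 * ∑ k ∈ Finset.Icc (1 : ℤ) n, V (2 * k) =
          2 * V (2 * n + 1) + V (2 * n - 1) - V (2 * n - 2)
            + V 0 - V 1 + 3 * V 2 - 2 * V 3) := by
  have hrec (m : ℤ) : V (m + 4) = V (m + 3) + V (m + 2) + V (m + 1) + V m := by
    convert hV (m + 4) using 4 <;> ring_nf
  have sum_succ (f : ℤ → ℤ) (n : ℤ) (hn : 1 ≤ n) :
      ∑ k ∈ Finset.Icc 1 (n + 1), f k = ∑ k ∈ Finset.Icc 1 n, f k + f (n + 1) := by
    rw [← Finset.insert_Icc_right_eq_Icc_add_one (by lia), Finset.sum_insert (by simp), add_comm]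
  intro n hn
  induction n, hn using Int.leInduction with
  | base =>
    have h := hrec 0
    norm_num at h ⊢
    lia
  | succ n hn ih =>
    obtain ⟨ha, hb, hc⟩ := ih
    simp only [sum_succ _ n hn, mul_add, ha, hb, hc]
    have h₁ := hrec (n - 1)
    have h₂ := hrec (2 * n)
    have h₃ := hrec (2 * n - 1)
    have h₄ := hrec (2 * n - 2)
    ring_nf at h₁ h₂ h₃ h₄ ⊢
    lia
end

section
/- Let (M_n) be the Tetranacci numbers indexed over all integers. Then for all integers n ≥ 1: (a) 3·∑_{k=1}^{n} M_k = M_{n+2} + 2M_n + M_{n-1} - 1; (b) 3·∑_{k=1}^{n} M_{2k+1} = 2M_{2n+2} + M_{2n} - M_{2n-1} - 2; (c) 3·∑_{k=1}^{n} M_{2k} = 2M_{2n+1} + M_{2n-1} - M_{2n-2} - 2. -/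
theorem sum_Icc_one_add_one (f : ℤ → ℤ) {m : ℤ} (hm : 1 ≤ m) :
    ∑ k ∈ Finset.Icc (1 : ℤ) (m + 1), f k = ∑ k ∈ Finset.Icc (1 : ℤ) m, f k + f (m + 1) := by
  rw [← Finset.insert_Icc_right_eq_Icc_add_one (by lia), Finset.sum_insert (by simp), add_comm]

/-- summation formulas for the Tetranacci numbers. -/
theorem tetranacci_sums
    (M : ℤ → ℤ)
    (hM0 : M 0 = 0) (hM1 : M 1 = 1) (hM2 : M 2 = 1) (hM3 : M 3 = 2)
    (hM : ∀ n : ℤ, M n = M (n - 1) + M (n - 2) + M (n - 3) + M (n - 4)) :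
    ∀ n : ℤ, 1 ≤ n →
      (3 * ∑ k ∈ Finset.Icc (1 : ℤ) n, M k = M (n + 2) + 2 * M n + M (n - 1) - 1) ∧
      (3 * ∑ k ∈ Finset.Icc (1 : ℤ) n, M (2 * k + 1) =
          2 * M (2 * n + 2) + M (2 * n) - M (2 * n - 1) - 2) ∧
      (3 * ∑ k ∈ Finset.Icc (1 : ℤ) n, M (2 * k) =
          2 * M (2 * n + 1) + M (2 * n - 1) - M (2 * n - 2) - 2) := by
  intro n hn
  induction n, hn using Int.leInduction with
  | base =>
    have hM4 := hM 4
    norm_num [hM0, hM1, hM2, hM3] at hM4 ⊢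
    simp [hM4]
  | succ m hm ih =>
    obtain ⟨iha, ihb, ihc⟩ := ih
    have h₁ := hM (m + 3)
    have h₂ := hM (2 * m + 4)
    have h₃ := hM (2 * m + 3)
    have h₄ := hM (2 * m + 2)
    simp only [sum_Icc_one_add_one _ hm, mul_add, iha, ihb, ihc]
    ring_nf at h₁ h₂ h₃ h₄ ⊢
    refine ⟨?_, ?_, ?_⟩ <;> linarith
end

section
/- Let (R_n) be the Tetranacci-Lucas numbers indexed over all integers. Then for all integers n ≥ 1: (a) 3·∑_{k=1}^{n} R_k = R_{n+2} + 2R_n + R_{n-1} - 10; (b) 3·∑_{k=1}^{n} R_{2k+1} = 2R_{2n+2} + R_{2n} - R_{2n-1} - 11; (c) 3·∑_{k=1}^{n} R_{2k} = 2R_{2n+1} + R_{2n-1} - R_{2n-2} - 2. -/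
/-- A sum over an integer interval is determined by its first term and its increments. -/
theorem mul_sum_Icc_eq_of_step (c : ℤ) (f F : ℤ → ℤ) (base : c * f 1 = F 1)
    (step : ∀ n, c * f (n + 1) = F (n + 1) - F n) (n : ℤ) (hn : 1 ≤ n) :
    c * ∑ k ∈ Finset.Icc 1 n, f k = F n := by
  induction n, hn using Int.leInduction with
  | base => simpa using base
  | succ n hn ih =>
    have hIcc : Finset.Icc 1 (n + 1) = insert (n + 1) (Finset.Icc 1 n) := by
      ext k
      simp only [Finset.mem_Icc, Finset.mem_insert]
      omega
    rw [hIcc, Finset.sum_insert (by simp), mul_add, ih, step]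
    ring

/-- summation formulas for the Tetranacci-Lucas numbers. -/
theorem tetranacci_lucas_sums
    (R : ℤ → ℤ)
    (hR0 : R 0 = 4) (hR1 : R 1 = 1) (hR2 : R 2 = 3) (hR3 : R 3 = 7)
    (hR : ∀ n : ℤ, R n = R (n - 1) + R (n - 2) + R (n - 3) + R (n - 4)) :
    ∀ n : ℤ, 1 ≤ n →
      (3 * ∑ k ∈ Finset.Icc (1 : ℤ) n, R k = R (n + 2) + 2 * R n + R (n - 1) - 10) ∧
      (3 * ∑ k ∈ Finset.Icc (1 : ℤ) n, R (2 * k + 1) =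
          2 * R (2 * n + 2) + R (2 * n) - R (2 * n - 1) - 11) ∧
      (3 * ∑ k ∈ Finset.Icc (1 : ℤ) n, R (2 * k) =
          2 * R (2 * n + 1) + R (2 * n - 1) - R (2 * n - 2) - 2) := by
  have hR4 : R 4 = 15 := by
    have h := hR 4
    norm_num [hR0, hR1, hR2, hR3] at h
    exact h
  intro n hn
  refine ⟨mul_sum_Icc_eq_of_step 3 R
      (fun n => R (n + 2) + 2 * R n + R (n - 1) - 10) ?_ (fun m => ?_) n hn,
    mul_sum_Icc_eq_of_step 3 (fun k => R (2 * k + 1))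
      (fun n => 2 * R (2 * n + 2) + R (2 * n) - R (2 * n - 1) - 11) ?_ (fun m => ?_) n hn,
    mul_sum_Icc_eq_of_step 3 (fun k => R (2 * k))
      (fun n => 2 * R (2 * n + 1) + R (2 * n - 1) - R (2 * n - 2) - 2) ?_ (fun m => ?_) n hn⟩
  · norm_num [hR0, hR1, hR3]
  · have h := hR (m + 3)
    ring_nf at h ⊢
    linarith
  · norm_num [hR1, hR2, hR3, hR4]
  · have h := hR (2 * m + 4)
    have h' := hR (2 * m + 3)
    ring_nf at h h' ⊢
    linarith
  · norm_num [hR0, hR1, hR2, hR3]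
  · have h := hR (2 * m + 3)
    have h' := hR (2 * m + 2)
    ring_nf at h h' ⊢
    linarith
end

section
/- Let (GM_n) and (GR_n) be the Gaussian Tetranacci and Gaussian Tetranacci-Lucas numbers, indexed over all integers. Then for every integer n: GR_n = -GM_{n+3} + 6GM_{n+1} - GM_n; GR_n = -GM_{n+2} + 5GM_{n+1} - 2GM_n - GM_{n-1}; and GR_n = 4GM_{n+1} - 3GM_n - 2GM_{n-1} - GM_{n-2}. -/
/-- A two-sided sequence satisfying the Tetranacci recurrence vanishes if it vanishes at
four consecutive indices. -/
theorem tetranacci_rec_eq_zero {A : Type*} [AddCommGroup A] {D : ℤ → A}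
    (hrec : ∀ n : ℤ, D n = D (n - 1) + D (n - 2) + D (n - 3) + D (n - 4))
    (h0 : D 0 = 0) (h1 : D 1 = 0) (h2 : D 2 = 0) (h3 : D 3 = 0) (n : ℤ) : D n = 0 := by
  suffices h : D n = 0 ∧ D (n + 1) = 0 ∧ D (n + 2) = 0 ∧ D (n + 3) = 0 from h.1
  induction n using Int.induction_on with
  | zero => simp [h0, h1, h2, h3]
  | succ k ih =>
    obtain ⟨ha, hb, hc, hd⟩ := ih
    have h := hrec (k + 4)
    clear hrec
    ring_nf at *
    simp_all
  | pred k ih =>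
    obtain ⟨ha, hb, hc, hd⟩ := ih
    have h := hrec (-k + 3)
    clear hrec
    ring_nf at *
    simp_all

/-- relations between Gaussian Tetranacci and Gaussian
Tetranacci-Lucas numbers. -/
theorem gaussian_tetranacci_lucas_relations
    (GM GR : ℤ → GaussianInt)
    (hM0 : GM 0 = 0) (hM1 : GM 1 = 1) (hM2 : GM 2 = 1 + gaussI) (hM3 : GM 3 = 2 + gaussI)
    (hMrec : ∀ n : ℤ, GM n = GM (n - 1) + GM (n - 2) + GM (n - 3) + GM (n - 4))
    (hR0 : GR 0 = 4 - gaussI) (hR1 : GR 1 = 1 + 4 * gaussI)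
    (hR2 : GR 2 = 3 + gaussI) (hR3 : GR 3 = 7 + 3 * gaussI)
    (hRrec : ∀ n : ℤ, GR n = GR (n - 1) + GR (n - 2) + GR (n - 3) + GR (n - 4)) :
    ∀ n : ℤ,
      (GR n = -GM (n + 3) + 6 * GM (n + 1) - GM n) ∧
      (GR n = -GM (n + 2) + 5 * GM (n + 1) - 2 * GM n - GM (n - 1)) ∧
      (GR n = 4 * GM (n + 1) - 3 * GM n - 2 * GM (n - 1) - GM (n - 2)) := by
  have hM4 := hMrec 4
  have hM5 := hMrec 5
  have hM6 := hMrec 6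
  norm_num [hM0, hM1, hM2, hM3] at hM4
  norm_num [hM1, hM2, hM3, hM4] at hM5
  norm_num [hM2, hM3, hM4, hM5] at hM6
  have key (n : ℤ) : GR n - (-GM (n + 3) + 6 * GM (n + 1) - GM n) = 0 := by
    refine tetranacci_rec_eq_zero
      (D := fun n => GR n - (-GM (n + 3) + 6 * GM (n + 1) - GM n)) (fun m => ?_) ?_ ?_ ?_ ?_ n
    · have hM := hMrec m
      have hM' := hMrec (m + 1)
      have hM'' := hMrec (m + 3)
      have hR := hRrec m
      ring_nf at *
      linear_combination hR + hM'' - 6 * hM' + hM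
    · norm_num [hR0, hM0, hM1, hM3]
      ring
    · norm_num [hR1, hM1, hM2, hM4]
      ring
    · norm_num [hR2, hM2, hM3, hM5]
      ring
    · norm_num [hR3, hM3, hM4, hM6]
      ring
  intro n
  have h := key n
  have hM := hMrec (n + 3)
  have hM' := hMrec (n + 2)
  ring_nf at *
  refine ⟨?_, ?_, ?_⟩
  · linear_combination h
  · linear_combination h - hM
  · linear_combination h - hM - hM'
end

section
/- Let (GM_n) and (GR_n) be the Gaussian Tetranacci and Gaussian Tetranacci-Lucas numbers, indexed over all integers. Then for all integers n ≥ 3: (1) (4-i)GM_{2n} - (9-4i)GM_{2n-2} - (6-7i)GM_{2n-4} + (1+i)GM_{2n-6} = (1+i)GR_{2n-2} + (1-i)GR_{2n-4} - iGR_{2n-6}; (2) (1+4i)GM_{2n} + (4-9i)GM_{2n-2} + (2-6i)GM_{2n-4} + (1+i)GM_{2n-6} = (1+i)GR_{2n-1} + (1-i)GR_{2n-3} - iGR_{2n-5}; (3) (4-i)GM_{2n+1} - (9-4i)GM_{2n-1} - (6-7i)GM_{2n-3} + (1+i)GM_{2n-5} = GR_{2n} - (1-i)GR_{2n-2} - (1-i)GR_{2n-4};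 (4) (1+4i)GM_{2n+1} + (4-9i)GM_{2n-1} + (2-6i)GM_{2n-3} + (1+i)GM_{2n-5} = GR_{2n+1} - (1-i)GR_{2n-1} - (1-i)GR_{2n-3}. -/
theorem gaussI_mul_self : gaussI * gaussI = -1 := by
  decide

/-- A two-sided sequence obeying the Tetranacci recurrence and vanishing at `0, 1, 2, 3`
vanishes everywhere. -/
theorem tetranacci_recurrence_eq_zero {A : Type*} [AddCommGroup A] {f : ℤ → A}
    (hf : ∀ n, f (n + 4) = f (n + 3) + f (n + 2) + f (n + 1) + f n)
    (h0 : f 0 = 0) (h1 : f 1 = 0) (h2 : f 2 = 0) (h3 : f 3 = 0) (n : ℤ) : f n = 0 := by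
  suffices h : f n = 0 ∧ f (n + 1) = 0 ∧ f (n + 2) = 0 ∧ f (n + 3) = 0 from h.1
  induction n with
  | zero => simpa using ⟨h0, h1, h2, h3⟩
  | succ k ih =>
    obtain ⟨ha, hb, hc, hd⟩ := ih
    have hr := hf k
    rw [ha, hb, hc, hd] at hr
    refine ⟨hb, ?_, ?_, ?_⟩
    · rwa [add_assoc]
    · rwa [add_assoc]
    · rw [add_assoc]
      simpa using hr
  | pred k ih =>
    obtain ⟨ha, hb, hc, hd⟩ := ih
    have hr := hf (-k - 1)
    rw [show (-k - 1 + 4 : ℤ) = -k + 3 by ring, show (-k - 1 + 3 : ℤ) = -k + 2 by ring,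
      show (-k - 1 + 2 : ℤ) = -k + 1 by ring, show (-k - 1 + 1 : ℤ) = -k by ring,
      ha, hb, hc, hd] at hr
    refine ⟨by simpa using hr.symm, ?_, ?_, ?_⟩
    · rwa [sub_add_cancel]
    · rwa [show (-k - 1 + 2 : ℤ) = -k + 1 by ring]
    · rwa [show (-k - 1 + 3 : ℤ) = -k + 2 by ring]

/-- The Gaussian Tetranacci-Lucas numbers as a combination of Gaussian Tetranacci numbers. -/
theorem gaussian_tetranacci_lucas_eq {GM GR : ℤ → GaussianInt}
    (hM0 : GM 0 = 0) (hM1 : GM 1 = 1) (hM2 : GM 2 = 1 + gaussI) (hM3 : GM 3 = 2 + gaussI)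
    (hM : ∀ n, GM (n + 4) = GM (n + 3) + GM (n + 2) + GM (n + 1) + GM n)
    (hR0 : GR 0 = 4 - gaussI) (hR1 : GR 1 = 1 + 4 * gaussI)
    (hR2 : GR 2 = 3 + gaussI) (hR3 : GR 3 = 7 + 3 * gaussI)
    (hR : ∀ n, GR (n + 4) = GR (n + 3) + GR (n + 2) + GR (n + 1) + GR n) (n : ℤ) :
    GR n = 6 * GM (n + 1) - GM n - GM (n + 3) := by
  have hM4 := hM 0
  have hM5 := hM 1
  have hM6 := hM 2
  norm_num [hM0, hM1, hM2, hM3] at hM4 hM5 hM6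
  rw [hM4] at hM5 hM6
  rw [hM5] at hM6
  refine sub_eq_zero.mp (tetranacci_recurrence_eq_zero
    (f := fun k => GR k - (6 * GM (k + 1) - GM k - GM (k + 3))) (fun k => ?_) ?_ ?_ ?_ ?_ n)
  · have e₁ := hM (k + 1)
    have e₃ := hM (k + 3)
    ring_nf at e₁ e₃ ⊢
    have e₀ := hM k
    have e := hR k
    ring_nf at e₀ e
    linear_combination e - 6 * e₁ + e₀ + e₃
  · norm_num [hR0, hM0, hM1, hM3]
    ring
  · norm_num [hR1, hM1, hM2, hM4]
    ring
  · norm_num [hR2, hM2, hM3, hM5]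
    ring
  · norm_num [hR3, hM3, hM4, hM6]
    ring

/-- identities between even/odd-indexed Gaussian Tetranacci and
Gaussian Tetranacci-Lucas numbers, for all integers `n ≥ 3`. -/
theorem gaussian_tetranacci_lucas_even_odd_identities
    (GM GR : ℤ → GaussianInt)
    (hM0 : GM 0 = 0) (hM1 : GM 1 = 1) (hM2 : GM 2 = 1 + gaussI) (hM3 : GM 3 = 2 + gaussI)
    (hMrec : ∀ n : ℤ, GM n = GM (n - 1) + GM (n - 2) + GM (n - 3) + GM (n - 4))
    (hR0 : GR 0 = 4 - gaussI) (hR1 : GR 1 = 1 + 4 * gaussI)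
    (hR2 : GR 2 = 3 + gaussI) (hR3 : GR 3 = 7 + 3 * gaussI)
    (hRrec : ∀ n : ℤ, GR n = GR (n - 1) + GR (n - 2) + GR (n - 3) + GR (n - 4)) :
    ∀ n : ℤ, 3 ≤ n →
      ((4 - gaussI) * GM (2 * n) - (9 - 4 * gaussI) * GM (2 * n - 2)
          - (6 - 7 * gaussI) * GM (2 * n - 4) + (1 + gaussI) * GM (2 * n - 6) =
        (1 + gaussI) * GR (2 * n - 2) + (1 - gaussI) * GR (2 * n - 4)
          - gaussI * GR (2 * n - 6)) ∧
      ((1 + 4 * gaussI) * GM (2 * n) + (4 - 9 * gaussI) * GM (2 * n - 2)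
          + (2 - 6 * gaussI) * GM (2 * n - 4) + (1 + gaussI) * GM (2 * n - 6) =
        (1 + gaussI) * GR (2 * n - 1) + (1 - gaussI) * GR (2 * n - 3)
          - gaussI * GR (2 * n - 5)) ∧
      ((4 - gaussI) * GM (2 * n + 1) - (9 - 4 * gaussI) * GM (2 * n - 1)
          - (6 - 7 * gaussI) * GM (2 * n - 3) + (1 + gaussI) * GM (2 * n - 5) =
        GR (2 * n) - (1 - gaussI) * GR (2 * n - 2) - (1 - gaussI) * GR (2 * n - 4)) ∧
      ((1 + 4 * gaussI) * GM (2 * n + 1) + (4 - 9 * gaussI) * GM (2 * n - 1)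
          + (2 - 6 * gaussI) * GM (2 * n - 3) + (1 + gaussI) * GM (2 * n - 5) =
        GR (2 * n + 1) - (1 - gaussI) * GR (2 * n - 1)
          - (1 - gaussI) * GR (2 * n - 3)) := by
  intro n _
  have hM (k : ℤ) : GM (k + 4) = GM (k + 3) + GM (k + 2) + GM (k + 1) + GM k := by
    rw [hMrec (k + 4)]
    ring_nf
  have hR (k : ℤ) : GR (k + 4) = GR (k + 3) + GR (k + 2) + GR (k + 1) + GR k := by
    rw [hRrec (k + 4)]
    ring_nf
  have hL := gaussian_tetranacci_lucas_eq hM0 hM1 hM2 hM3 hM hR0 hR1 hR2 hR3 hR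
  obtain ⟨m, hm⟩ : ∃ m, 2 * n = m + 6 := ⟨2 * n - 6, by ring⟩
  have e₄ := hM m
  have e₅ := hM (m + 1)
  have e₆ := hM (m + 2)
  have e₇ := hM (m + 3)
  have e₈ := hM (m + 4)
  have e₉ := hM (m + 5)
  have e₁₀ := hM (m + 6)
  have hI := gaussI_mul_self
  simp only [hm, hL]
  ring_nf at e₄ e₅ e₆ e₇ e₈ e₉ e₁₀ ⊢
  simp only [e₁₀, e₉, e₈, e₇, e₆, e₅, e₄]
  refine ⟨?_, ?_, ?_, ?_⟩ <;> grind
end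

section
/- Let (GV_n) be a Gaussian generalized Tetranacci sequence and (M_n) the Tetranacci numbers, both indexed over all integers. Then for all integers m ≥ 0 and n ≥ 0, GV_{m+n} = M_{m-2}·GV_{n+3} + (M_{m-3}+M_{m-4}+M_{m-5})·GV_{n+2} + (M_{m-3}+M_{m-4})·GV_{n+1} + M_{m-3}·GV_n. -/
/-- addition formula for Gaussian generalized Tetranacci numbers in
terms of the Tetranacci numbers. -/
theorem gaussian_generalized_tetranacci_addition_formula
    (c₀ c₁ c₂ c₃ : ℤ) (GV : ℤ → GaussianInt) (M : ℤ → ℤ)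
    (h0 : GV 0 = (c₀ : GaussianInt) + ((c₃ - c₂ - c₁ - c₀ : ℤ) : GaussianInt) * gaussI)
    (h1 : GV 1 = (c₁ : GaussianInt) + (c₀ : GaussianInt) * gaussI)
    (h2 : GV 2 = (c₂ : GaussianInt) + (c₁ : GaussianInt) * gaussI)
    (h3 : GV 3 = (c₃ : GaussianInt) + (c₂ : GaussianInt) * gaussI)
    (hrec : ∀ n : ℤ, GV n = GV (n - 1) + GV (n - 2) + GV (n - 3) + GV (n - 4))
    (hM0 : M 0 = 0) (hM1 : M 1 = 1) (hM2 : M 2 = 1) (hM3 : M 3 = 2)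
    (hM : ∀ n : ℤ, M n = M (n - 1) + M (n - 2) + M (n - 3) + M (n - 4)) :
    ∀ m n : ℤ, 0 ≤ m → 0 ≤ n →
      GV (m + n) =
        (M (m - 2) : GaussianInt) * GV (n + 3)
          + ((M (m - 3) + M (m - 4) + M (m - 5) : ℤ) : GaussianInt) * GV (n + 2)
          + ((M (m - 3) + M (m - 4) : ℤ) : GaussianInt) * GV (n + 1)
          + (M (m - 3) : GaussianInt) * GV n := by
  have hMneg1 : M (-1) = 0 := by have := hM 3; norm_num at this; omega
  have hMneg2 : M (-2) = 0 := by have := hM 2; norm_num at this; omega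
  have hMneg3 : M (-3) = 1 := by have := hM 1; norm_num at this; omega
  have hMneg4 : M (-4) = -1 := by have := hM 0; norm_num at this; omega
  have hMneg5 : M (-5) = 0 := by have := hM (-1); norm_num at this; omega
  intro m n hm hn
  induction m, hm using Int.leInduction generalizing n with
  | base => simp [hMneg2, hMneg3, hMneg4, hMneg5]
  | succ m _ ih =>
    have hGV : GV (n + 1 + 3) = GV (n + 3) + GV (n + 2) + GV (n + 1) + GV n := by
      rw [hrec (n + 1 + 3)]
      ring_nf
    have hMm : M (m + 1 - 2) = M (m - 2) + M (m - 3) + M (m - 4) + M (m - 5) := by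
      rw [hM (m + 1 - 2)]
      ring_nf
    rw [show m + 1 + n = m + (n + 1) by ring, ih (n + 1) (by omega), hGV, hMm,
      show n + 1 + 2 = n + 3 by ring, show n + 1 + 1 = n + 2 by ring,
      show m + 1 - 3 = m - 2 by ring, show m + 1 - 4 = m - 3 by ring,
      show m + 1 - 5 = m - 4 by ring]
    push_cast
    ring
end

section
/- Let A be the 4×4 matrix over the Gaussian integers with rows (1,1,1,1), (1,0,0,0), (0,1,0,0), (0,0,1,0), let N_M be the 4×4 matrix over the Gaussian integers with rows (2+i, 1+i, 1, 0), (1+i, 1, 0, 0), (1, 0, 0, i), (0, 0, i, 1-i), and let (GM_n) be the Gaussian Tetranacci numbers indexed over all integers. Then for every natural number n ≥ 3, A^n · N_M equals the 4×4 matrix whose rows are (GM_{n+3}, GM_{n+2}, GM_{n+1}, GM_n), (GM_{n+2}, GM_{n+1}, GM_n, GM_{n-1}), (GM_{n+1}, GM_n, GM_{n-1}, GM_{n-2}), (GM_n, GM_{n-1}, GM_{n-2}, GM_{n-3}). -/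
/-- Multiplying on the left by the Tetranacci companion matrix shifts the Hankel matrix of a
Tetranacci sequence by one index. -/
theorem tetranacci_companion_mul_hankel {R : Type*} [CommRing R] (u : ℤ → R)
    (hrec : ∀ n : ℤ, u n = u (n - 1) + u (n - 2) + u (n - 3) + u (n - 4)) (m : ℤ) :
    (!![1, 1, 1, 1; 1, 0, 0, 0; 0, 1, 0, 0; 0, 0, 1, 0] : Matrix (Fin 4) (Fin 4) R) *
        Matrix.of (fun i j : Fin 4 => u (m + 3 - (i : ℕ) - (j : ℕ))) =
      Matrix.of (fun i j : Fin 4 => u (m + 1 + 3 - (i : ℕ) - (j : ℕ))) := by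
  ext i j
  fin_cases i
  · have h := hrec (m + 1 + 3 - (j : ℕ))
    rw [show m + 1 + 3 - ((j : ℕ) : ℤ) - 1 = m + 3 - (j : ℕ) by ring,
      show m + 1 + 3 - ((j : ℕ) : ℤ) - 2 = m + 3 - 1 - (j : ℕ) by ring,
      show m + 1 + 3 - ((j : ℕ) : ℤ) - 3 = m + 3 - 2 - (j : ℕ) by ring,
      show m + 1 + 3 - ((j : ℕ) : ℤ) - 4 = m + 3 - 3 - (j : ℕ) by ring] at h
    simp [Matrix.mul_apply, Fin.sum_univ_four, h]
  all_goals
    simp [Matrix.mul_apply, Fin.sum_univ_four]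
    congr 1; ring

/-- `Aⁿ · N_M` in terms of Gaussian Tetranacci numbers, for `n ≥ 3`. -/
theorem gaussian_tetranacci_matrix_identity
    (GM : ℤ → GaussianInt)
    (h0 : GM 0 = 0) (h1 : GM 1 = 1) (h2 : GM 2 = 1 + gaussI) (h3 : GM 3 = 2 + gaussI)
    (hrec : ∀ n : ℤ, GM n = GM (n - 1) + GM (n - 2) + GM (n - 3) + GM (n - 4)) :
    ∀ n : ℕ, 3 ≤ n →
      (!![1, 1, 1, 1; 1, 0, 0, 0; 0, 1, 0, 0; 0, 0, 1, 0] :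
            Matrix (Fin 4) (Fin 4) GaussianInt) ^ n *
          !![2 + gaussI, 1 + gaussI, 1, 0;
             1 + gaussI, 1, 0, 0;
             1, 0, 0, gaussI;
             0, 0, gaussI, 1 - gaussI] =
        !![GM ((n : ℤ) + 3), GM ((n : ℤ) + 2), GM ((n : ℤ) + 1), GM (n : ℤ);
           GM ((n : ℤ) + 2), GM ((n : ℤ) + 1), GM (n : ℤ), GM ((n : ℤ) - 1);
           GM ((n : ℤ) + 1), GM (n : ℤ), GM ((n : ℤ) - 1), GM ((n : ℤ) - 2);
           GM (n : ℤ), GM ((n : ℤ) - 1), GM ((n : ℤ) - 2), GM ((n : ℤ) - 3)] := by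
  rintro n -
  have hm1 : GM (-1) = 0 := by
    have h := hrec 3
    norm_num [h0, h1, h2, h3] at h
    linear_combination -h
  have hm2 : GM (-2) = gaussI := by
    have h := hrec 2
    norm_num [h0, h1, h2, hm1] at h
    linear_combination -h
  have hm3 : GM (-3) = 1 - gaussI := by
    have h := hrec 1
    norm_num [h0, h1, hm1, hm2] at h
    linear_combination -h
  have hankel (m : ℤ) :
      !![GM (m + 3), GM (m + 2), GM (m + 1), GM m;
         GM (m + 2), GM (m + 1), GM m, GM (m - 1);
         GM (m + 1), GM m, GM (m - 1), GM (m - 2);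
         GM m, GM (m - 1), GM (m - 2), GM (m - 3)] =
        Matrix.of (fun i j : Fin 4 => GM (m + 3 - (i : ℕ) - (j : ℕ))) := by
    ext1 i j
    fin_cases i <;> fin_cases j <;> simp <;> congr 1 <;> ring
  rw [hankel]
  induction n with
  | zero =>
    rw [Nat.cast_zero, ← hankel]
    simp [h0, h1, h2, h3, hm1, hm2, hm3]
  | succ k ih =>
    rw [pow_succ', Matrix.mul_assoc, ih, tetranacci_companion_mul_hankel GM hrec, Nat.cast_succ]
end

section
/- Let A be the 4×4 matrix over the Gaussian integers with rows (1,1,1,1), (1,0,0,0), (0,1,0,0), (0,0,1,0), let N_R be the 4×4 matrix over the Gaussian integers with rows (7+3i, 3+i, 1+4i, 4-i), (3+i, 1+4i, 4-i, -1-i), (1+4i, 4-i, -1-i, -1-i), (4-i, -1-i, -1-i, -1+7i), and let (GR_n) be the Gaussian Tetranacci-Lucas numbers indexed over all integers. Then for every natural number n ≥ 3, A^n · N_R equals the 4×4 matrix whose rows are (GR_{n+3}, GR_{n+2}, GR_{n+1}, GR_n), (GR_{n+2}, GR_{n+1}, GR_n, GR_{n-1}), (GR_{n+1}, GR_n, GR_{n-1},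 GR_{n-2}), (GR_n, GR_{n-1}, GR_{n-2}, GR_{n-3}). -/
/-- Over any ring, the `n`-th power of the Tetranacci companion matrix shifts by `n` the Hankel
matrix of a sequence satisfying the Tetranacci recurrence. -/
theorem tetranacci_companion_pow_mul_hankel {R : Type*} [Ring R] (u : ℤ → R)
    (hrec : ∀ n : ℤ, u n = u (n - 1) + u (n - 2) + u (n - 3) + u (n - 4)) (n : ℕ) :
    (!![1, 1, 1, 1; 1, 0, 0, 0; 0, 1, 0, 0; 0, 0, 1, 0] : Matrix (Fin 4) (Fin 4) R) ^ n *
        !![u 3, u 2, u 1, u 0;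
           u 2, u 1, u 0, u (-1);
           u 1, u 0, u (-1), u (-2);
           u 0, u (-1), u (-2), u (-3)] =
      !![u ((n : ℤ) + 3), u ((n : ℤ) + 2), u ((n : ℤ) + 1), u (n : ℤ);
         u ((n : ℤ) + 2), u ((n : ℤ) + 1), u (n : ℤ), u ((n : ℤ) - 1);
         u ((n : ℤ) + 1), u (n : ℤ), u ((n : ℤ) - 1), u ((n : ℤ) - 2);
         u (n : ℤ), u ((n : ℤ) - 1), u ((n : ℤ) - 2), u ((n : ℤ) - 3)] := by
  induction n with
  | zero => simp
  | succ k ih =>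
    rw [pow_succ', mul_assoc, ih]
    have e4 := hrec (k + 1 + 3)
    have e3 := hrec (k + 1 + 2)
    have e2 := hrec (k + 1 + 1)
    have e1 := hrec (k + 1)
    ring_nf at e1 e2 e3 e4
    ext i j
    fin_cases i <;> fin_cases j <;>
      simp [Matrix.mul_apply, Fin.sum_univ_four] <;> ring_nf <;>
      simp only [e1, e2, e3, e4]

/-- `Aⁿ · N_R` in terms of Gaussian Tetranacci-Lucas numbers,
for `n ≥ 3`. -/
theorem gaussian_tetranacci_lucas_matrix_identity
    (GR : ℤ → GaussianInt)
    (h0 : GR 0 = 4 - gaussI) (h1 : GR 1 = 1 + 4 * gaussI)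
    (h2 : GR 2 = 3 + gaussI) (h3 : GR 3 = 7 + 3 * gaussI)
    (hrec : ∀ n : ℤ, GR n = GR (n - 1) + GR (n - 2) + GR (n - 3) + GR (n - 4)) :
    ∀ n : ℕ, 3 ≤ n →
      (!![1, 1, 1, 1; 1, 0, 0, 0; 0, 1, 0, 0; 0, 0, 1, 0] :
            Matrix (Fin 4) (Fin 4) GaussianInt) ^ n *
          !![7 + 3 * gaussI, 3 + gaussI, 1 + 4 * gaussI, 4 - gaussI;
             3 + gaussI, 1 + 4 * gaussI, 4 - gaussI, -1 - gaussI;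
             1 + 4 * gaussI, 4 - gaussI, -1 - gaussI, -1 - gaussI;
             4 - gaussI, -1 - gaussI, -1 - gaussI, -1 + 7 * gaussI] =
        !![GR ((n : ℤ) + 3), GR ((n : ℤ) + 2), GR ((n : ℤ) + 1), GR (n : ℤ);
           GR ((n : ℤ) + 2), GR ((n : ℤ) + 1), GR (n : ℤ), GR ((n : ℤ) - 1);
           GR ((n : ℤ) + 1), GR (n : ℤ), GR ((n : ℤ) - 1), GR ((n : ℤ) - 2);
           GR (n : ℤ), GR ((n : ℤ) - 1), GR ((n : ℤ) - 2), GR ((n : ℤ) - 3)] := by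
  intro n _
  have hm1 : GR (-1) = -1 - gaussI := by
    have h := hrec 3
    norm_num [h0, h1, h2, h3] at h
    linear_combination -h
  have hm2 : GR (-2) = -1 - gaussI := by
    have h := hrec 2
    norm_num [h0, h1, h2, hm1] at h
    linear_combination -h
  have hm3 : GR (-3) = -1 + 7 * gaussI := by
    have h := hrec 1
    norm_num [h0, h1, hm1, hm2] at h
    linear_combination -h
  have key := tetranacci_companion_pow_mul_hankel GR hrec n
  rwa [h3, h2, h1, h0, hm1, hm2, hm3] at key
end
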